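/- Let A ∈ ℝⁿˣⁿ be nonnegative with all row sums at most β_max < 1, p, c, c' ∈ ℝⁿ nonnegative vectors with c ≤ c' componentwise, and let p̄, p̄' be the unique fixed points of Φ(x) = p ∧ (Aᵀx + c) and Φ'(x) = p ∧ (Aᵀx + c') respectively on [0, p]. Then p̄ ≤ p̄' componentwise. -/

import Mathlib

open Matrix

/-- Comparison Lemma for the Eisenberg–Noe model: increasing external assets pointwise
increases the clearing payment vector pointwise. -/
theorem clearing_comparison (n : ℕ) (A : Matrix (Fin n) (Fin n) ℝ) (βmax : ℝ)
    (hA : ∀ i j, 0 ≤ A i j) (hrow : ∀ i, ∑ j, A i j ≤ βmax) (hβ : βmax < 1)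
    (p c c' : Fin n → ℝ) (hp : ∀ i, 0 ≤ p i) (hc : ∀ i, 0 ≤ c i)
    (hcc' : ∀ i, c i ≤ c' i)
    (pbar pbar' : Fin n → ℝ)
    (hbar0 : ∀ i, 0 ≤ pbar i) (hbarp : ∀ i, pbar i ≤ p i)
    (hbar'0 : ∀ i, 0 ≤ pbar' i) (hbar'p : ∀ i, pbar' i ≤ p i)
    (hfix : ∀ i, pbar i = min (p i) ((Aᵀ.mulVec pbar) i + c i))
    (hfix' : ∀ i, pbar' i = min (p i) ((Aᵀ.mulVec pbar') i + c' i)) :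
    ∀ i, pbar i ≤ pbar' i := by
  have hm : ∀ (x : Fin n → ℝ) (i : Fin n), (Aᵀ.mulVec x) i = ∑ j, A j i * x j := by
    intro x i
    simp [Matrix.mulVec, dotProduct]
  have hd0 : ∀ i, 0 ≤ max 0 (pbar i - pbar' i) := fun i => le_max_left _ _
  have key : ∀ i, max 0 (pbar i - pbar' i) ≤ ∑ j, A j i * max 0 (pbar j - pbar' j) := by
    intro i
    have hs : 0 ≤ ∑ j, A j i * max 0 (pbar j - pbar' j) :=
      Finset.sum_nonneg fun j _ => mul_nonneg (hA j i) (hd0 j)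
    refine max_le hs ?_
    have h1 : pbar i ≤ (∑ j, A j i * pbar j) + c i := by
      rw [← hm, hfix i]
      exact min_le_right _ _
    have h2 := hfix' i
    rw [hm] at h2
    rcases min_choice (p i) ((∑ j, A j i * pbar' j) + c' i) with h | h
    · rw [h] at h2
      linarith [hbarp i]
    · rw [h] at h2
      have h3 : ∑ j, A j i * pbar j - ∑ j, A j i * pbar' j
          ≤ ∑ j, A j i * max 0 (pbar j - pbar' j) := by
        rw [← Finset.sum_sub_distrib]
        refine Finset.sum_le_sum fun j _ => ?_
        rw [← mul_sub]
        exact mul_le_mul_of_nonneg_left (le_max_right _ _) (hA j i)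
      linarith [hcc' i]
  have hS : ∑ i, max 0 (pbar i - pbar' i) ≤ βmax * ∑ i, max 0 (pbar i - pbar' i) := by
    calc ∑ i, max 0 (pbar i - pbar' i)
        ≤ ∑ i, ∑ j, A j i * max 0 (pbar j - pbar' j) := Finset.sum_le_sum fun i _ => key i
      _ = ∑ j, (∑ i, A j i) * max 0 (pbar j - pbar' j) := by
        rw [Finset.sum_comm]
        simp_rw [Finset.sum_mul]
      _ ≤ ∑ j, βmax * max 0 (pbar j - pbar' j) :=
        Finset.sum_le_sum fun j _ => mul_le_mul_of_nonneg_right (hrow j) (hd0 j)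
      _ = _ := by rw [Finset.mul_sum]
  intro i
  have h4 : max 0 (pbar i - pbar' i) ≤ ∑ i, max 0 (pbar i - pbar' i) :=
    Finset.single_le_sum (f := fun i => max 0 (pbar i - pbar' i))
      (fun j _ => hd0 j) (Finset.mem_univ i)
  have h5 := le_max_right 0 (pbar i - pbar' i)
  by_contra hlt
  have h6 : 0 < ∑ i, max 0 (pbar i - pbar' i) := by linarith
  nlinarith
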